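/- Let N ≥ 2, let {(u_i,w_i)}_{i=1}^m ⊆ S^{N-1} × [0,∞) be an ε-accurate quadrature, let 𝒮 = {u_i}_{i=1}^m have dispersion δ = disp(𝒮), and assume ε, δ ≤ 1/(10√N). Let γ ≥ 0, set e = δ(L_C + 12√N(‖C‖_∞ + γ)), and for 𝓑 ∈ 𝒟^γ define 𝓑^e = ⋂_{u ∈ 𝒮} Π^-(u, B(𝓑,u) + e). Then 𝓑^e ∈ 𝒞^{γ+β} where β = 4e + 32√N(‖C‖_∞ + γ)ε. -/

import Mathlib

open MeasureTheory Metric Set TopologicalSpace Filter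
open scoped RealInnerProductSpace NNReal ENNReal

noncomputable section

abbrev Euc (N : ℕ) := EuclideanSpace ℝ (Fin N)

/-- The outreach (support) function of a set. -/
def outreach {N : ℕ} (B : Set (Euc N)) (u : Euc N) : ℝ :=
  sSup ((fun b => ⟪b, u⟫) '' B)

/-- The half-space `Π⁻(u,b)`. -/
def halfSpace {N : ℕ} (u : Euc N) (b : ℝ) : Set (Euc N) := {x | ⟪u, x⟫ ≤ b}

/-- The uniform probability measure on the unit sphere. -/
def sphereMeasure (N : ℕ) : Measure (Metric.sphere (0 : Euc N) 1) :=
  (((volume : Measure (Euc N)).toSphere) Set.univ)⁻¹ • ((volume : Measure (Euc N)).toSphere)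

/-- The sup-norm of a function restricted to the unit sphere. -/
def supNormSphere {N : ℕ} (f : Euc N → ℝ) : ℝ :=
  ⨆ x : Metric.sphere (0 : Euc N) 1, |f x|

/-- The dispersion of a set of directions. -/
def dispersion {N : ℕ} (S : Set (Euc N)) : ℝ :=
  ⨆ u : Metric.sphere (0 : Euc N) 1, ⨅ v : S, ‖(u : Euc N) - (v : Euc N)‖

/-- `ε`-accurate quadrature on the unit sphere. -/
def IsAccurateQuadrature {N : ℕ} {ι : Type*} [Fintype ι]
    (u : ι → Euc N) (w : ι → ℝ) (ε : ℝ) : Prop :=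
  (∀ i, u i ∈ Metric.sphere (0 : Euc N) 1) ∧ (∀ i, 0 ≤ w i) ∧
  ∀ (L : ℝ≥0) (f : Euc N → ℝ), LipschitzOnWith L f (Metric.sphere (0 : Euc N) 1) →
    |(∫ x : Metric.sphere (0 : Euc N) 1, f x ∂(sphereMeasure N)) - ∑ i, w i * f (u i)|
      ≤ ε * (L + supNormSphere f)

/-- Halved mean width. -/
def meanHalfWidth {N : ℕ} (B : Set (Euc N)) : ℝ :=
  ∫ u : Metric.sphere (0 : Euc N) 1, outreach B (u : Euc N) ∂(sphereMeasure N)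

/-- Feasible solutions of the continuous problem. -/
def CInf {N : ℕ} (C : Euc N → ℝ) : Set (Set (Euc N)) :=
  {B | B.Nonempty ∧ Convex ℝ B ∧ IsCompact B ∧
    ∀ u ∈ Metric.sphere (0 : Euc N) 1, C u ≤ outreach B u}

/-- Optimal value of the continuous problem. -/
def VCP {N : ℕ} (C : Euc N → ℝ) : ℝ := sInf (meanHalfWidth '' CInf C)

/-- `γ`-near optimal solutions of the continuous problem. -/
def CGamma {N : ℕ} (C : Euc N → ℝ) (γ : ℝ) : Set (Set (Euc N)) :=
  {B ∈ CInf C | meanHalfWidth B - VCP C ≤ γ}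

/-- Feasible solutions of the discrete problem with node set `S`. -/
def DInf {N : ℕ} (C : Euc N → ℝ) (S : Set (Euc N)) : Set (Set (Euc N)) :=
  {B | B.Nonempty ∧ Convex ℝ B ∧ IsCompact B ∧ ∀ u ∈ S, C u ≤ outreach B u}

/-- Discrete objective. -/
def quadSum {N : ℕ} {ι : Type*} [Fintype ι] (u : ι → Euc N) (w : ι → ℝ)
    (B : Set (Euc N)) : ℝ :=
  ∑ i, w i * outreach B (u i)

/-- Optimal value of the discrete problem. -/
def VDP {N : ℕ} {ι : Type*} [Fintype ι] (u : ι → Euc N) (w : ι → ℝ) (C : Euc N → ℝ) : ℝ :=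
  sInf (quadSum u w '' DInf C (Set.range u))

/-- `γ`-near optimal solutions of the discrete problem. -/
def DGamma {N : ℕ} {ι : Type*} [Fintype ι] (u : ι → Euc N) (w : ι → ℝ) (C : Euc N → ℝ)
    (γ : ℝ) : Set (Set (Euc N)) :=
  {B ∈ DInf C (Set.range u) | quadSum u w B - VDP u w C ≤ γ}


lemma polar_sep {N : ℕ} (hN : 2 ≤ N) (g : Euc N → ℝ) (φ : ℝ → ℝ) (f : Euc N → ℝ)
    (hf : ∀ (x : Metric.sphere (0 : Euc N) 1) (r : ℝ), 0 < r → f (r • (x : Euc N)) = g x * φ r) :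
    ∫ x, f x = (∫ x : Metric.sphere (0 : Euc N) 1, g x ∂(volume : Measure (Euc N)).toSphere) *
      ∫ r in Ioi (0 : ℝ), r ^ (N - 1) * φ r := by
  have : Nonempty (Fin N) := ⟨⟨0, by omega⟩⟩
  have : Nontrivial (Euc N) := inferInstance
  calc ∫ x, f x = ∫ x : ({(0 : Euc N)}ᶜ : Set (Euc N)), f x ∂(volume.comap Subtype.val) := by
        rw [integral_subtype_comap (measurableSet_singleton _).compl fun x ↦ f x,
          restrict_compl_singleton]
    _ = ∫ x : Metric.sphere (0 : Euc N) 1 × Ioi (0 : ℝ), g x.1 * φ x.2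
          ∂((volume : Measure (Euc N)).toSphere.prod (.volumeIoiPow (Module.finrank ℝ (Euc N) - 1))) := by
        rw [← (volume : Measure (Euc N)).measurePreserving_homeomorphUnitSphereProd.integral_comp
          (Homeomorph.measurableEmbedding _)]
        congr 1
        ext x
        have hx : 0 < ‖(x : Euc N)‖ := norm_pos_iff.2 x.2
        have h0 := hf (homeomorphUnitSphereProd (Euc N) x).1 (homeomorphUnitSphereProd (Euc N) x).2
          (homeomorphUnitSphereProd (Euc N) x).2.2
        refine Eq.trans ?_ h0
        congr 1
        simp [smul_smul, hx.ne']
    _ = _ := by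
        rw [integral_prod_mul (fun x : Metric.sphere (0 : Euc N) 1 => g x)
          (fun r : Ioi (0 : ℝ) => φ r)]
        congr 1
        simp only [Measure.volumeIoiPow, ENNReal.ofReal]
        rw [integral_withDensity_eq_integral_smul (by fun_prop),
          integral_subtype_comap measurableSet_Ioi fun a ↦ Real.toNNReal (a ^ (Module.finrank ℝ (Euc N) - 1)) • φ a,
          setIntegral_congr_fun measurableSet_Ioi fun x hx ↦ ?_]
        simp [NNReal.smul_def, pow_nonneg (le_of_lt (show (0:ℝ) < x from hx))]

lemma radial_int (k : ℕ) :
    ∫ r in Ioi (0 : ℝ), r ^ k * Real.exp (-r ^ 2) = (1 / 2) * Real.Gamma (((k : ℝ) + 1) / 2) := by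
  have h := integral_rpow_mul_exp_neg_mul_rpow (p := 2) (q := k) (b := 1) (by norm_num)
    (by have : (0:ℝ) ≤ k := Nat.cast_nonneg k
        linarith) one_pos
  rw [Real.one_rpow, one_mul] at h
  rw [← h]
  refine setIntegral_congr_fun measurableSet_Ioi fun x hx ↦ ?_
  simp

lemma pos_gauss : ∫ x : ℝ, max x 0 * Real.exp (-x ^ 2) = 1 / 2 := by
  have h := radial_int 1
  rw [show (((1:ℕ):ℝ) + 1) / 2 = 1 by norm_num, Real.Gamma_one, mul_one] at h
  rw [← h, ← integral_indicator measurableSet_Ioi]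
  congr 1
  ext x
  by_cases hx : 0 < x
  · simp [hx, hx.le]
  · simp [hx, not_lt.1 hx]

lemma gauss_pos_part {N : ℕ} (hN : 2 ≤ N) (e : Euc N) (he : ‖e‖ = 1) :
    ∫ x : Euc N, max ⟪e, x⟫ 0 * Real.exp (-‖x‖ ^ 2) = (1 / 2) * (√Real.pi) ^ (N - 1) := by
  set i0 : Fin N := ⟨0, by omega⟩ with hi0
  obtain ⟨b, hb⟩ := Orthonormal.exists_orthonormalBasis_extension_of_card_eq (𝕜 := ℝ) (E := Euc N)
    (ι := Fin N) (by simp) (v := fun _ => e) (s := {i0}) (by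
      constructor
      · intro i; simpa using he
      · intro i j hij; exact absurd (Subsingleton.elim i j) hij)
  have hb0 : b i0 = e := hb i0 rfl
  let F : Euc N → ℝ := fun y => max (y i0) 0 * Real.exp (-‖y‖ ^ 2)
  have h1 : ∫ x : Euc N, max ⟪e, x⟫ 0 * Real.exp (-‖x‖ ^ 2) = ∫ x : Euc N, F (b.repr x) := by
    congr 1
    ext x
    simp only [F, OrthonormalBasis.repr_apply_apply, hb0, LinearIsometryEquiv.norm_map]
  have h2 : ∫ x : Euc N, F (b.repr x) = ∫ y, F y :=
    b.measurePreserving_repr.integral_comp b.repr.toHomeomorph.measurableEmbedding F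
  have h3 : ∫ y, F y = ∫ y : Fin N → ℝ, F (WithLp.toLp 2 y) :=
    ((PiLp.volume_preserving_toLp (Fin N)).integral_comp
      (MeasurableEquiv.toLp 2 (Fin N → ℝ)).measurableEmbedding F).symm
  let q : Fin N → ℝ → ℝ := fun i t => (if i = i0 then max t 0 else 1) * Real.exp (-t ^ 2)
  have h4 : ∀ y : Fin N → ℝ, F (WithLp.toLp 2 y) = ∏ i, q i (y i) := by
    intro y
    simp only [F, q, Finset.prod_mul_distrib, ← Real.exp_sum]
    rw [Finset.prod_ite_eq' Finset.univ i0 (fun i => max (y i) 0)]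
    simp [EuclideanSpace.norm_sq_eq]
  rw [h1, h2, h3]
  simp only [h4]
  rw [integral_fintype_prod_volume_eq_prod, ← Finset.mul_prod_erase _ _ (Finset.mem_univ i0)]
  congr 1
  · simp only [q, if_true]; exact pos_gauss
  · rw [Finset.prod_congr rfl (g := fun _ => √Real.pi)]
    · simp
    · intro i hi
      have := integral_gaussian 1
      simp only [q, if_neg (Finset.ne_of_mem_erase hi), one_mul]
      simpa using this

lemma gauss_full (N : ℕ) :
    ∫ x : Euc N, Real.exp (-‖x‖ ^ 2) = (√Real.pi) ^ N := by
  have h3 : ∫ y : Euc N, Real.exp (-‖y‖ ^ 2)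
      = ∫ y : Fin N → ℝ, Real.exp (-‖(WithLp.toLp 2 y : Euc N)‖ ^ 2) :=
    ((PiLp.volume_preserving_toLp (Fin N)).integral_comp
      (MeasurableEquiv.toLp 2 (Fin N → ℝ)).measurableEmbedding
        (fun y : Euc N => Real.exp (-‖y‖ ^ 2))).symm
  have h4 : ∀ y : Fin N → ℝ, Real.exp (-‖(WithLp.toLp 2 y : Euc N)‖ ^ 2)
      = ∏ i, (fun (_ : Fin N) (t : ℝ) => Real.exp (-t ^ 2)) i (y i) := by
    intro y
    simp [← Real.exp_sum, EuclideanSpace.norm_sq_eq]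
  rw [h3, integral_congr_ae (Filter.Eventually.of_forall h4),
    integral_fintype_prod_volume_eq_prod (fun (_ : Fin N) (t : ℝ) => Real.exp (-t ^ 2))]
  have := integral_gaussian 1
  simp only [neg_mul, one_mul, div_one] at this
  simp [this]

lemma gamma_ratio {x : ℝ} (hx : 0 < x) : Real.Gamma (x + 1 / 2) ≤ √x * Real.Gamma x := by
  have h := Real.Gamma_mul_add_mul_le_rpow_Gamma_mul_rpow_Gamma (s := x) (t := x + 1) (a := 1 / 2)
    (b := 1 / 2) hx (by linarith) (by norm_num) (by norm_num) (by norm_num)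
  have hG := Real.Gamma_pos_of_pos hx
  rw [Real.Gamma_add_one hx.ne', ← Real.sqrt_eq_rpow, ← Real.sqrt_eq_rpow,
    Real.sqrt_mul hx.le, show (1 / 2 : ℝ) * x + 1 / 2 * (x + 1) = x + 1 / 2 by ring] at h
  calc _ ≤ _ := h
    _ = √x * (√(Real.Gamma x) * √(Real.Gamma x)) := by ring
    _ = _ := by rw [Real.mul_self_sqrt hG.le]

lemma sphere_prob {N : ℕ} (hN : 2 ≤ N) : IsProbabilityMeasure (sphereMeasure N) := by
  have : Nonempty (Fin N) := ⟨⟨0, by omega⟩⟩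
  have : Nontrivial (Euc N) := inferInstance
  constructor
  rw [sphereMeasure, Measure.smul_apply, smul_eq_mul]
  apply ENNReal.inv_mul_cancel
  · exact (Measure.measure_univ_ne_zero).2 (Measure.toSphere_ne_zero _)
  · exact measure_ne_top _ _

lemma sphere_pos_part_unit {N : ℕ} (hN : 2 ≤ N) (e : Euc N) (he : ‖e‖ = 1) :
    0.3989 / √N ≤ ∫ x : Metric.sphere (0 : Euc N) 1, max ⟪e, (x : Euc N)⟫ 0 ∂(sphereMeasure N) := by
  have hN0 : (0 : ℝ) < N := by positivity
  have h1 := polar_sep hN (fun x => max ⟪e, x⟫ 0) (fun r => r * Real.exp (-r ^ 2))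
    (fun x => max ⟪e, x⟫ 0 * Real.exp (-‖x‖ ^ 2)) (by
      intro x r hr
      have hx : ‖(x : Euc N)‖ = 1 := by simp
      simp only [inner_smul_right, norm_smul, hx, Real.norm_eq_abs, mul_one, sq_abs]
      rw [← mul_assoc, show max (r * ⟪e, (x : Euc N)⟫) 0 = r * max ⟪e, (x : Euc N)⟫ 0 by
        rw [mul_max_of_nonneg _ _ hr.le, mul_zero]]
      ring)
  have h2 := polar_sep hN (fun x => 1) (fun r => Real.exp (-r ^ 2))
    (fun x => Real.exp (-‖x‖ ^ 2)) (by
      intro x r hr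
      have hx : ‖(x : Euc N)‖ = 1 := by simp
      simp only [norm_smul, hx, Real.norm_eq_abs, mul_one, sq_abs, one_mul])
  rw [gauss_pos_part hN e he] at h1
  rw [gauss_full] at h2
  have h3 : ∫ r in Ioi (0 : ℝ), r ^ (N - 1) * (r * Real.exp (-r ^ 2))
      = (1 / 2) * Real.Gamma ((N : ℝ) / 2 + 1 / 2) := by
    have := radial_int N
    rw [show ((N : ℝ) + 1) / 2 = (N : ℝ) / 2 + 1 / 2 by ring] at this
    rw [← this]
    congr 1
    ext r
    rw [← mul_assoc, ← pow_succ, Nat.sub_add_cancel (by omega)]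
  have h4 : ∫ r in Ioi (0 : ℝ), r ^ (N - 1) * Real.exp (-r ^ 2)
      = (1 / 2) * Real.Gamma ((N : ℝ) / 2) := by
    rw [radial_int, Nat.cast_sub (by omega)]
    norm_num
  rw [h3] at h1
  rw [h4] at h2
  rw [sphereMeasure, integral_smul_measure]
  set A := ∫ x : Metric.sphere (0 : Euc N) 1, max ⟪e, (x : Euc N)⟫ 0 ∂(volume : Measure (Euc N)).toSphere
  simp only [integral_const, smul_eq_mul, mul_one, Measure.real] at h2
  rw [ENNReal.toReal_inv, smul_eq_mul]
  set T := ((volume : Measure (Euc N)).toSphere univ).toReal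
  have hG := Real.Gamma_pos_of_pos (half_pos hN0)
  have hr := gamma_ratio (half_pos hN0)
  set G := Real.Gamma ((N : ℝ) / 2)
  have hG1 := Real.Gamma_pos_of_pos (show 0 < (N : ℝ) / 2 + 1 / 2 by positivity)
  set G1 := Real.Gamma ((N : ℝ) / 2 + 1 / 2)
  have hp : 0 < √Real.pi := Real.sqrt_pos.2 Real.pi_pos
  set p := √Real.pi with hpdef
  have hT : T = 2 * p ^ N / G := by field_simp; linarith
  have hA : A = p ^ (N - 1) / G1 := by field_simp; linarith
  have hpN : p ^ N = p ^ (N - 1) * p := by rw [← pow_succ, Nat.sub_add_cancel (by omega)]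
  have hTA : T⁻¹ * A = G / (2 * p * G1) := by
    rw [hT, hA, hpN]; field_simp
  rw [hTA, div_le_div_iff₀ (by positivity) (by positivity)]
  have h5 : √((N : ℝ) / 2) * p * (2 * 0.3989) ≤ √N := by
    rw [hpdef, ← Real.sqrt_mul (by positivity)]
    rw [← Real.sqrt_sq (show (0:ℝ) ≤ 2 * 0.3989 by norm_num), ← Real.sqrt_mul (by positivity)]
    apply Real.sqrt_le_sqrt
    have := Real.pi_lt_d4
    nlinarith
  calc 0.3989 * (2 * p * G1) ≤ 0.3989 * (2 * p * (√((N : ℝ) / 2) * G)) := by gcongr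
    _ = (√((N : ℝ) / 2) * p * (2 * 0.3989)) * G := by ring
    _ ≤ √N * G := by gcongr
    _ = _ := by ring

lemma sphere_pos_part {N : ℕ} (hN : 2 ≤ N) (b : Euc N) :
    0.3989 / √N * ‖b‖ ≤
      ∫ x : Metric.sphere (0 : Euc N) 1, max ⟪b, (x : Euc N)⟫ 0 ∂(sphereMeasure N) := by
  by_cases hb : b = 0
  · simp [hb]
  have hb' : 0 < ‖b‖ := norm_pos_iff.2 hb
  have h := sphere_pos_part_unit hN (‖b‖⁻¹ • b) (by
    rw [norm_smul, norm_inv, norm_norm, inv_mul_cancel₀ hb'.ne'])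
  have : ∀ x : Metric.sphere (0 : Euc N) 1, max ⟪b, (x : Euc N)⟫ 0
      = ‖b‖ * max ⟪‖b‖⁻¹ • b, (x : Euc N)⟫ 0 := by
    intro x
    rw [mul_max_of_nonneg _ _ hb'.le, mul_zero, real_inner_smul_left, mul_inv_cancel_left₀ hb'.ne']
  simp only [this]
  rw [integral_const_mul, mul_comm]
  gcongr

lemma le_outreach {N : ℕ} {B : Set (Euc N)} (hc : IsCompact B) {b : Euc N} (hb : b ∈ B)
    (u : Euc N) : ⟪b, u⟫ ≤ outreach B u := by
  apply le_csSup
  · exact (hc.image (by fun_prop)).bddAbove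
  · exact ⟨b, hb, rfl⟩

lemma outreach_le {N : ℕ} {B : Set (Euc N)} (hn : B.Nonempty) {u : Euc N} {c : ℝ}
    (h : ∀ b ∈ B, ⟪b, u⟫ ≤ c) : outreach B u ≤ c := by
  apply csSup_le (hn.image _)
  rintro _ ⟨b, hb, rfl⟩
  exact h b hb

lemma outreach_sub_le {N : ℕ} {B : Set (Euc N)} (hn : B.Nonempty) (hc : IsCompact B) {R : ℝ}
    (hR : ∀ b ∈ B, ‖b‖ ≤ R) (u v : Euc N) : outreach B u ≤ outreach B v + R * ‖u - v‖ := by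
  apply outreach_le hn
  intro b hb
  have h1 : ⟪b, u⟫ = ⟪b, v⟫ + ⟪b, u - v⟫ := by rw [inner_sub_right]; ring
  have h2 := le_outreach hc hb v
  have h3 := real_inner_le_norm b (u - v)
  have h4 : ‖b‖ * ‖u - v‖ ≤ R * ‖u - v‖ := by gcongr; exact hR b hb
  linarith

lemma abs_outreach_le {N : ℕ} {B : Set (Euc N)} (hn : B.Nonempty) (hc : IsCompact B) {R : ℝ}
    (hR : ∀ b ∈ B, ‖b‖ ≤ R) {u : Euc N} (hu : ‖u‖ = 1) : |outreach B u| ≤ R := by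
  rw [abs_le]
  constructor
  · obtain ⟨b, hb⟩ := hn
    have h1 := le_outreach hc hb u
    have h2 := abs_real_inner_le_norm b u
    rw [hu, mul_one, abs_le] at h2
    linarith [hR b hb]
  · apply outreach_le hn
    intro b hb
    have h2 := real_inner_le_norm b u
    rw [hu, mul_one] at h2
    linarith [hR b hb]

lemma outreach_lip {N : ℕ} {B : Set (Euc N)} (hn : B.Nonempty) (hc : IsCompact B) {R : ℝ}
    (hR0 : 0 ≤ R) (hR : ∀ b ∈ B, ‖b‖ ≤ R) : LipschitzWith ⟨R, hR0⟩ (outreach B) := by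
  apply LipschitzWith.of_le_add_mul
  intro u v
  rw [dist_eq_norm]
  exact outreach_sub_le hn hc hR u v

lemma supNormSphere_le {N : ℕ} {f : Euc N → ℝ} {c : ℝ} (hc : 0 ≤ c)
    (h : ∀ x : Euc N, ‖x‖ = 1 → |f x| ≤ c) : supNormSphere f ≤ c :=
  Real.iSup_le (fun x => h x (by simp)) hc

lemma supNormSphere_nonneg {N : ℕ} (f : Euc N → ℝ) : 0 ≤ supNormSphere f :=
  Real.iSup_nonneg fun _ => abs_nonneg _

lemma abs_le_supNormSphere {N : ℕ} {f : Euc N → ℝ} {L : ℝ≥0}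
    (hf : LipschitzOnWith L f (Metric.sphere (0 : Euc N) 1)) {x : Euc N} (hx : ‖x‖ = 1) :
    |f x| ≤ supNormSphere f := by
  have hcont : Continuous fun x : Metric.sphere (0 : Euc N) 1 => |f x| :=
    (continuousOn_iff_continuous_domRestrict.1 hf.continuousOn).abs
  have hb : BddAbove (range fun x : Metric.sphere (0 : Euc N) 1 => |f x|) :=
    (isCompact_range hcont).bddAbove
  exact le_ciSup hb (⟨x, by simpa using hx⟩ : Metric.sphere (0 : Euc N) 1)

lemma exists_near {N m : ℕ} (hm : 0 < m) (u : Fin m → Euc N) (hu : ∀ i, ‖u i‖ = 1)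
    {x : Euc N} (hx : ‖x‖ = 1) : ∃ i, ‖x - u i‖ ≤ dispersion (Set.range u) := by
  have hne : Nonempty (range u) := ⟨⟨u ⟨0, hm⟩, mem_range_self _⟩⟩
  have hbb : ∀ y : Euc N, BddBelow (range fun v : range u => ‖y - (v : Euc N)‖) := fun y =>
    ⟨0, by rintro _ ⟨v, rfl⟩; exact norm_nonneg _⟩
  have hb : BddAbove (range fun y : Metric.sphere (0 : Euc N) 1 =>
      ⨅ v : range u, ‖(y : Euc N) - (v : Euc N)‖) := by
    refine ⟨2, ?_⟩
    rintro _ ⟨y, rfl⟩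
    refine (ciInf_le (hbb y) ⟨u ⟨0, hm⟩, mem_range_self _⟩).trans ?_
    have h1 := norm_sub_le (y : Euc N) (u ⟨0, hm⟩)
    have h2 : ‖(y : Euc N)‖ = 1 := by simp
    rw [h2, hu] at h1
    simp only
    linarith
  have h := le_ciSup hb (⟨x, by simpa using hx⟩ : Metric.sphere (0 : Euc N) 1)
  obtain ⟨⟨_, i, rfl⟩, hv⟩ := exists_eq_ciInf_of_finite (f := fun v : range u => ‖x - (v : Euc N)‖)
  refine ⟨i, ?_⟩
  simp only at hv
  rw [hv]
  exact h

lemma dispersion_nonneg {N : ℕ} (S : Set (Euc N)) : 0 ≤ dispersion S :=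
  Real.iSup_nonneg fun _ => Real.iInf_nonneg fun _ => norm_nonneg _

lemma ball_outreach {N : ℕ} {K : ℝ} (hK : 0 ≤ K) {u : Euc N} (hu : ‖u‖ = 1) :
    outreach (Metric.closedBall (0 : Euc N) K) u = K := by
  have hn : (Metric.closedBall (0 : Euc N) K).Nonempty := ⟨0, by simpa using hK⟩
  apply le_antisymm
  · exact (abs_le.1 (abs_outreach_le hn (isCompact_closedBall _ _) (by simp) hu)).2
  · have h := le_outreach (isCompact_closedBall (0 : Euc N) K) (b := K • u)
      (by simp [norm_smul, hu, abs_of_nonneg hK]) u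
    rw [real_inner_smul_left, real_inner_self_eq_norm_sq, hu] at h
    linarith

/-- radius bound from the mean half width -/
lemma radius_cont {N : ℕ} (hN : 2 ≤ N) {A : Set (Euc N)} (hc : IsCompact A) {K : ℝ}
    (hK0 : 0 ≤ K) (hn : A.Nonempty) (hK : ∀ x : Euc N, ‖x‖ = 1 → -K ≤ outreach A x) (b : Euc N) (hb : b ∈ A) :
    0.3989 / √N * ‖b‖ ≤ meanHalfWidth A + K := by
  have := sphere_prob hN
  obtain ⟨R, hR⟩ := hc.isBounded.exists_norm_le
  have hR0 : 0 ≤ R := (norm_nonneg b).trans (hR b hb)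
  refine (sphere_pos_part hN b).trans ?_
  have hcont : Continuous fun x : Metric.sphere (0 : Euc N) 1 => outreach A x :=
    (outreach_lip hn hc hR0 hR).continuous.comp continuous_subtype_val
  have hi : Integrable (fun x : Metric.sphere (0 : Euc N) 1 => outreach A x) (sphereMeasure N) :=
    hcont.integrable_of_hasCompactSupport (HasCompactSupport.of_compactSpace _)
  have hi2 : Integrable (fun x : Metric.sphere (0 : Euc N) 1 => max ⟪b, (x : Euc N)⟫ 0)
      (sphereMeasure N) :=
    Continuous.integrable_of_hasCompactSupport (by fun_prop) (HasCompactSupport.of_compactSpace _)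
  have h1 : meanHalfWidth A + K
      = ∫ x : Metric.sphere (0 : Euc N) 1, (outreach A x + K) ∂(sphereMeasure N) := by
    rw [integral_add hi (integrable_const _)]
    simp [meanHalfWidth]
  rw [h1]
  refine integral_mono hi2 (hi.add (integrable_const _)) ?_
  intro x
  have hx : ‖(x : Euc N)‖ = 1 := by simp
  have h2 := hK x hx
  have h3 := le_outreach hc hb (x : Euc N)
  simp only
  apply max_le
  · linarith
  · linarith

lemma quad_one {N m : ℕ} (hN : 2 ≤ N) {u : Fin m → Euc N} {w : Fin m → ℝ} {ε : ℝ}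
    (hq : IsAccurateQuadrature u w ε) : 0 ≤ ε ∧ |1 - ∑ i, w i| ≤ ε := by
  have := sphere_prob hN
  have : Nonempty (Fin N) := ⟨⟨0, by omega⟩⟩
  have : Nontrivial (Euc N) := inferInstance
  have : Nonempty (Metric.sphere (0 : Euc N) 1) :=
    (NormedSpace.sphere_nonempty.2 zero_le_one).to_subtype
  have h := hq.2.2 0 (fun _ => 1) (LipschitzWith.const _).lipschitzOnWith
  simp [supNormSphere] at h
  exact ⟨(abs_nonneg _).trans h, h⟩

lemma quad_outreach {N m : ℕ} {u : Fin m → Euc N} {w : Fin m → ℝ} {ε : ℝ} (hε : 0 ≤ ε)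
    (hq : IsAccurateQuadrature u w ε) {A : Set (Euc N)} (hn : A.Nonempty) (hc : IsCompact A)
    {R : ℝ} (hR0 : 0 ≤ R) (hR : ∀ b ∈ A, ‖b‖ ≤ R) :
    |meanHalfWidth A - quadSum u w A| ≤ ε * (2 * R) := by
  refine (hq.2.2 ⟨R, hR0⟩ (outreach A) (outreach_lip hn hc hR0 hR).lipschitzOnWith).trans ?_
  gcongr
  have := supNormSphere_le hR0 fun x hx => abs_outreach_le hn hc hR hx
  change R + _ ≤ _
  linarith

lemma quad_pos_part {N m : ℕ} (hN : 2 ≤ N) {u : Fin m → Euc N} {w : Fin m → ℝ} {ε : ℝ} (hε : 0 ≤ ε)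
    (hq : IsAccurateQuadrature u w ε) (b : Euc N) :
    0.3989 / √N * ‖b‖ ≤ ∑ i, w i * max ⟪b, u i⟫ 0 + ε * (2 * ‖b‖) := by
  have hl : LipschitzWith ‖b‖₊ fun x : Euc N => max ⟪b, x⟫ 0 := by
    apply LipschitzWith.of_le_add_mul
    intro x y
    rw [dist_eq_norm, coe_nnnorm]
    have h1 : ⟪b, x⟫ = ⟪b, y⟫ + ⟪b, x - y⟫ := by rw [inner_sub_right]; ring
    have h3 := real_inner_le_norm b (x - y)
    have h4 : 0 ≤ ‖b‖ * ‖x - y‖ := by positivity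
    apply max_le
    · linarith [le_max_left ⟪b, y⟫ 0]
    · linarith [le_max_right ⟪b, y⟫ 0]
  have h := hq.2.2 ‖b‖₊ _ hl.lipschitzOnWith
  have hs : supNormSphere (fun x : Euc N => max ⟪b, x⟫ 0) ≤ ‖b‖ := by
    apply supNormSphere_le (norm_nonneg b)
    intro x hx
    rw [abs_of_nonneg (le_max_right _ _)]
    apply max_le _ (norm_nonneg b)
    have := real_inner_le_norm b x
    rwa [hx, mul_one] at this
  have h2 := sphere_pos_part hN b
  have h3 := (abs_le.1 h).2
  have h4 : ε * (‖b‖₊ + supNormSphere (fun x : Euc N => max ⟪b, x⟫ 0)) ≤ ε * (2 * ‖b‖) := by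
    gcongr
    rw [coe_nnnorm]
    linarith
  linarith

set_option maxHeartbeats 1000000 in
theorem inflated_mem_CGamma_discrete {N m : ℕ} (hN : 2 ≤ N)
    (u : Fin m → Euc N) (w : Fin m → ℝ) (ε : ℝ)
    (hq : IsAccurateQuadrature u w ε)
    (δ : ℝ) (hδ : δ = dispersion (Set.range u))
    (hε : ε ≤ 1 / (10 * Real.sqrt N)) (hδ' : δ ≤ 1 / (10 * Real.sqrt N))
    (C : Euc N → ℝ) (LC : ℝ≥0) (hC : LipschitzOnWith LC C (Metric.sphere (0 : Euc N) 1))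
    (γ : ℝ) (hγ : 0 ≤ γ) (B : Set (Euc N)) (hB : B ∈ DGamma u w C γ)
    (e : ℝ) (he : e = δ * ((LC : ℝ) + 12 * Real.sqrt N * (supNormSphere C + γ)))
    (β : ℝ) (hβ : β = 4 * e + 32 * Real.sqrt N * (supNormSphere C + γ) * ε) :
    (⋂ v ∈ Set.range u, halfSpace v (outreach B v + e)) ∈ CGamma C (γ + β) := by
  have hprob := sphere_prob hN
  obtain ⟨hε0, hw⟩ := quad_one hN hq
  have hu : ∀ i, ‖u i‖ = 1 := fun i => by simpa using hq.1 i
  have hw0 := hq.2.1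
  set K := supNormSphere C with hKdef
  have hK0 : 0 ≤ K := supNormSphere_nonneg C
  have hCK : ∀ x : Euc N, ‖x‖ = 1 → |C x| ≤ K := fun x hx => abs_le_supNormSphere hC hx
  have hs2 : √(N : ℝ) ^ 2 = N := Real.sq_sqrt (by positivity)
  have hN2 : (2 : ℝ) ≤ N := by exact_mod_cast hN
  have hs : 1.4142 ≤ √(N : ℝ) := Real.le_sqrt_of_sq_le (by norm_num; linarith)
  set s := √(N : ℝ) with hsdef
  have hs0 : 0 < s := by linarith
  have hεs : ε * s ≤ 0.1 := by
    rw [le_div_iff₀ (by positivity)] at hε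
    linarith
  have hδs : δ * s ≤ 0.1 := by
    rw [le_div_iff₀ (by positivity)] at hδ'
    linarith
  have hδ0 : 0 ≤ δ := hδ ▸ dispersion_nonneg _
  have hε1 : ε ≤ 0.07072 := by nlinarith
  have hδ1 : δ ^ 2 ≤ 0.005 := by
    have : (δ * s) ^ 2 ≤ 0.1 ^ 2 := pow_le_pow_left₀ (by positivity) hδs 2
    rw [mul_pow, hs2] at this
    nlinarith [sq_nonneg δ]
  have he0 : 0 ≤ e := by rw [he]; positivity
  have hw1 := (abs_le.1 hw).1
  have hw2 := (abs_le.1 hw).2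
  have hm : 0 < m := by
    rcases Nat.eq_zero_or_pos m with h | h
    · subst h
      simp at hw2
      linarith
    · exact h
  have hnear : ∀ x : Euc N, ‖x‖ = 1 → ∃ i, ‖x - u i‖ ≤ δ := fun x hx => by
    rw [hδ]; exact exists_near hm u hu hx
  obtain ⟨⟨hBn, hBconv, hBc, hBC⟩, hBγ⟩ := hB
  -- discrete value bounded below
  have hbdd : BddBelow (quadSum u w '' DInf C (Set.range u)) := by
    refine ⟨∑ i, w i * C (u i), ?_⟩
    rintro _ ⟨A, hA, rfl⟩
    exact Finset.sum_le_sum fun i _ =>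
      mul_le_mul_of_nonneg_left (hA.2.2.2 _ (mem_range_self i)) (hw0 i)
  have hVDP : ∀ A ∈ DInf C (Set.range u), VDP u w C ≤ quadSum u w A := fun A hA =>
    csInf_le hbdd ⟨A, hA, rfl⟩
  have hCD : ∀ A ∈ CInf C, A ∈ DInf C (Set.range u) := by
    rintro A ⟨h1, h2, h3, h4⟩
    refine ⟨h1, h2, h3, ?_⟩
    rintro _ ⟨i, rfl⟩
    exact h4 _ (hq.1 i)
  have hballC : Metric.closedBall (0 : Euc N) K ∈ CInf C := by
    refine ⟨⟨0, by simpa using hK0⟩, convex_closedBall _ _, isCompact_closedBall _ _, ?_⟩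
    intro x hx
    have hx : ‖x‖ = 1 := by simpa using hx
    rw [ball_outreach hK0 hx]
    exact (abs_le.1 (hCK x hx)).2
  have hballQ : quadSum u w (Metric.closedBall (0 : Euc N) K) = (∑ i, w i) * K := by
    rw [quadSum, Finset.sum_mul]
    exact Finset.sum_congr rfl fun i _ => by rw [ball_outreach hK0 (hu i)]
  have hballM : meanHalfWidth (Metric.closedBall (0 : Euc N) K) = K := by
    rw [meanHalfWidth, integral_congr_ae (g := fun _ => K)]
    · simp
    · exact Filter.Eventually.of_forall fun x => ball_outreach hK0 (by simp)
  have hBQ : quadSum u w B ≤ (1 + ε) * K + γ := by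
    have h1 := hVDP _ (hCD _ hballC)
    rw [hballQ] at h1
    nlinarith
  -- radius of B
  obtain ⟨b0, hb0, hb0max⟩ := hBc.exists_isMaxOn hBn continuous_norm.continuousOn
  have hR : ∀ b ∈ B, ‖b‖ ≤ ‖b0‖ := fun b hb => hb0max hb
  have hR0 : 0 ≤ ‖b0‖ := norm_nonneg b0
  have hpp := quad_pos_part hN hε0 hq b0
  rw [← hsdef] at hpp
  have hsum : ∑ i, w i * max ⟪b0, u i⟫ 0 ≤ quadSum u w B + (∑ i, w i) * K := by
    rw [quadSum, Finset.sum_mul, ← Finset.sum_add_distrib]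
    refine Finset.sum_le_sum fun i _ => ?_
    rw [← mul_add]
    refine mul_le_mul_of_nonneg_left ?_ (hw0 i)
    have h1 := hBC _ (mem_range_self i)
    have h2 := (abs_le.1 (hCK _ (hu i))).1
    have h3 := le_outreach hBc hb0 (u i)
    apply max_le <;> linarith
  set R := ‖b0‖ with hRdef
  have hRb : 0.1989 * R ≤ s * (2.14144 * K + γ) := by
    have h1 : 0.3989 / s * R ≤ 2 * (1 + ε) * K + γ + ε * (2 * R) := by nlinarith
    have h2 : 0.3989 * R ≤ s * (2 * (1 + ε) * K + γ + ε * (2 * R)) := by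
      calc 0.3989 * R = s * (0.3989 / s * R) := by field_simp
        _ ≤ _ := by gcongr
    have h3 : s * (ε * (2 * R)) ≤ 0.2 * R := by nlinarith
    have h4 : s * (2 * (1 + ε) * K + γ) ≤ s * (2.14144 * K + γ) := by
      gcongr; linarith
    nlinarith
  have hsK : 0 ≤ s * K := by positivity
  have hsγ : 0 ≤ s * γ := by positivity
  have hRb' : R ≤ 10.77 * (s * K) + 5.1 * (s * γ) := by nlinarith
  -- the inflated set
  set D : Set (Euc N) := ⋂ v ∈ Set.range u, halfSpace v (outreach B v + e) with hD
  have memD : ∀ x, x ∈ D ↔ ∀ i, ⟪u i, x⟫ ≤ outreach B (u i) + e := by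
    intro x
    simp [hD, halfSpace]
  have hDball : ∀ b ∈ B, ∀ y : Euc N, ‖y‖ ≤ 1 → b + e • y ∈ D := by
    intro b hb y hy
    rw [memD]
    intro i
    rw [inner_add_right, real_inner_smul_right, real_inner_comm]
    have h1 := le_outreach hBc hb (u i)
    have h2 := real_inner_le_norm (u i) y
    rw [hu, one_mul] at h2
    nlinarith
  have hDn : D.Nonempty := by
    refine ⟨_, hDball b0 hb0 0 (by simp)⟩
  have hDconv : Convex ℝ D := by
    rw [hD]
    refine convex_iInter₂ fun v _ => ?_
    exact convex_halfSpace_le (innerSL ℝ v).isLinear _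
  have hDclosed : IsClosed D := by
    rw [hD]
    refine isClosed_biInter fun v _ => ?_
    exact isClosed_le (by fun_prop) continuous_const
  have hDR : ∀ x ∈ D, ‖x‖ ≤ 1.00251 * (R + e) := by
    intro x hx
    by_cases hx0 : x = 0
    · subst hx0
      rw [norm_zero]; positivity
    have hxp : 0 < ‖x‖ := norm_pos_iff.2 hx0
    have hy1 : ‖‖x‖⁻¹ • x‖ = 1 := by
      rw [norm_smul, norm_inv, norm_norm, inv_mul_cancel₀ hxp.ne']
    obtain ⟨i, hi⟩ := hnear _ hy1
    have h1 := norm_sub_sq_real (‖x‖⁻¹ • x) (u i)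
    rw [hy1, hu, real_inner_smul_left, real_inner_comm] at h1
    have h2 := (memD x).1 hx i
    have h3 := (abs_le.1 (abs_outreach_le hBn hBc hR (hu i))).2
    have h4 : ‖‖x‖⁻¹ • x - u i‖ ^ 2 ≤ 0.005 :=
      (pow_le_pow_left₀ (norm_nonneg _) hi 2).trans hδ1
    have h5 : 0.9975 ≤ ‖x‖⁻¹ * ⟪u i, x⟫ := by linarith
    have h6 : 0.9975 * ‖x‖ ≤ ⟪u i, x⟫ := by
      calc 0.9975 * ‖x‖ ≤ (‖x‖⁻¹ * ⟪u i, x⟫) * ‖x‖ := by gcongr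
        _ = _ := by field_simp
    linarith
  have hDc : IsCompact D := Metric.isCompact_of_isClosed_isBounded hDclosed
    (isBounded_iff_forall_norm_le.2 ⟨_, hDR⟩)
  have hDout : ∀ x : Euc N, ‖x‖ = 1 → outreach B x + e ≤ outreach D x := by
    intro x hx
    suffices h : outreach B x ≤ outreach D x - e by linarith
    apply outreach_le hBn
    intro b hb
    have h := le_outreach hDc (hDball b hb x hx.le) x
    rw [inner_add_left, real_inner_smul_left, real_inner_self_eq_norm_sq, hx] at h
    linarith
  have hDC : D ∈ CInf C := by
    refine ⟨hDn, hDconv, hDc, ?_⟩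
    intro x hx
    have hx1 : ‖x‖ = 1 := by simpa using hx
    obtain ⟨i, hi⟩ := hnear x hx1
    have h1 := hDout x hx1
    have h2 := outreach_sub_le hBn hBc hR (u i) x
    have h3 := hBC _ (mem_range_self i)
    have h4 := hC.dist_le_mul x hx (u i) (hq.1 i)
    rw [Real.dist_eq, dist_eq_norm] at h4
    have h5 := (abs_le.1 h4).2
    rw [norm_sub_rev] at h2
    have h6 : R * ‖x - u i‖ ≤ R * δ := by gcongr
    have h7 : (LC : ℝ) * ‖x - u i‖ ≤ LC * δ := by gcongr
    have h8 : R * δ ≤ (12 * s * (K + γ)) * δ := by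
      gcongr
      nlinarith
    rw [he] at h1
    nlinarith
  refine ⟨hDC, ?_⟩
  -- value estimate
  have hDq := (abs_le.1 (quad_outreach hε0 hq hDn hDc
    (show 0 ≤ 1.00251 * (R + e) by positivity) hDR)).2
  have hDB : quadSum u w D ≤ quadSum u w B + (∑ i, w i) * e := by
    rw [quadSum, quadSum, Finset.sum_mul, ← Finset.sum_add_distrib]
    refine Finset.sum_le_sum fun i _ => ?_
    rw [← mul_add]
    refine mul_le_mul_of_nonneg_left ?_ (hw0 i)
    apply outreach_le hDn
    intro b hb
    rw [real_inner_comm]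
    exact (memD b).1 hb i
  have hsmall : ∀ A ∈ CInf C, meanHalfWidth A ≤ K →
      meanHalfWidth D - (γ + β) ≤ meanHalfWidth A := by
    intro A hA hAK
    obtain ⟨a0, ha0, ha0max⟩ := hA.2.2.1.exists_isMaxOn hA.1 continuous_norm.continuousOn
    have hRA : ∀ a ∈ A, ‖a‖ ≤ ‖a0‖ := fun a ha => ha0max ha
    have h1 := radius_cont hN hA.2.2.1 hK0 hA.1 (fun x hx => by
      have h1 := hA.2.2.2 x (by simpa using hx)
      have h2 := (abs_le.1 (hCK x hx)).1
      linarith) a0 ha0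
    rw [← hsdef] at h1
    have h2 := (abs_le.1 (quad_outreach hε0 hq hA.1 hA.2.2.1 (norm_nonneg a0) hRA)).1
    have h3 := hVDP _ (hCD _ hA)
    have h4 : ‖a0‖ ≤ 5.014 * (s * K) := by
      have : 0.3989 * ‖a0‖ ≤ s * (2 * K) := by
        calc 0.3989 * ‖a0‖ = s * (0.3989 / s * ‖a0‖) := by field_simp
          _ ≤ _ := mul_le_mul_of_nonneg_left (by linarith) hs0.le
      linarith
    have h5 : (∑ i, w i) * e ≤ 1.07072 * e := by
      gcongr; linarith
    have h6 : ε * (2 * (1.00251 * (R + e))) ≤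
        ε * (2.00502 * (10.77 * (s * K) + 5.1 * (s * γ))) + 0.2 * e := by
      have h61 : ε * e ≤ 0.07072 * e := by gcongr
      have h62 : ε * R ≤ ε * (10.77 * (s * K) + 5.1 * (s * γ)) := by gcongr
      linarith
    have h7 : ε * (2 * ‖a0‖) ≤ ε * (2 * (5.014 * (s * K))) := by gcongr
    have h8 : 0 ≤ ε * (s * K) := by positivity
    have h9 : 0 ≤ ε * (s * γ) := by positivity
    rw [hβ]
    have h10 : 32 * s * (K + γ) * ε = 32 * (ε * (s * K)) + 32 * (ε * (s * γ)) := by ring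
    rw [h10]
    linarith
  have hV : meanHalfWidth D - (γ + β) ≤ VCP C := by
    refine le_csInf ⟨_, _, hballC, rfl⟩ ?_
    rintro _ ⟨A, hA, rfl⟩
    rcases le_or_gt (meanHalfWidth A) K with h | h
    · exact hsmall A hA h
    · have := hsmall _ hballC hballM.le
      rw [hballM] at this
      linarith
  linarith
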